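/- Let C be a category and let L : C ⥤ C be an endofunctor equipped with an idempotent structure η. Let W be the class of morphisms f of C such that L(f) is an isomorphism, and let D be the essential image of L. Then the corestricted functor C ⥤ D induced by L exhibits D as the localization of C at W: it sends every morphism of W to an isomorphism and satisfies the universal property of localization (in Mathlib terms, it satisfies Functor.IsLocalization with respect to W). -/

import Mathlib

open CategoryTheory

section IdempotentEndofunctor

variable {C : Type*} [Category C] {L : C ⥤ C} (η : 𝟭 C ⟶ L)

/-- If `η` is invertible on the values of `L`, it is invertible on the essential image of `L`. -/
lemma isIso_app_of_essImage (h₁ : ∀ X : C, IsIso (η.app (L.obj X))) {Z : C}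
    (hZ : L.essImage Z) : IsIso (η.app Z) := by
  obtain ⟨X, ⟨e⟩⟩ := hZ
  have := h₁ X
  exact (NatTrans.isIso_app_iff_of_iso η e).1 this

/-- For an idempotent structure `η` on `L`, precomposition with `η.app X` is a bijection on
morphisms into objects of the essential image of `L`. -/
lemma bijective_app_comp (h₁ : ∀ X : C, IsIso (η.app (L.obj X)))
    (h₂ : ∀ X : C, IsIso (L.map (η.app X))) (X : C) {Z : C} (hZ : L.essImage Z) :
    Function.Bijective (fun g : L.obj X ⟶ Z => η.app X ≫ g) := by
  have := isIso_app_of_essImage η h₁ hZ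
  have := h₂ X
  refine ⟨fun g g' h => ?_, fun f => ⟨L.map f ≫ inv (η.app Z), ?_⟩⟩
  · have hL : L.map g = L.map g' := by
      rw [← cancel_epi (L.map (η.app X)), ← L.map_comp, ← L.map_comp]
      exact congrArg L.map h
    have hg := η.naturality g
    have hg' := η.naturality g'
    dsimp at hg hg'
    rw [← cancel_mono (η.app Z), hg, hg', hL]
  · have hf := η.naturality f
    dsimp at hf ⊢
    rw [← reassoc_of% hf, IsIso.hom_inv_id, Category.comp_id]

/-- For an idempotent structure `η` on `L`, morphisms from `L.toEssImage.obj X` to `Z` in the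
essential image of `L` correspond to morphisms from `X` to `Z`, by precomposition with `η.app X`. -/
noncomputable def toEssImageHomEquiv (h₁ : ∀ X : C, IsIso (η.app (L.obj X)))
    (h₂ : ∀ X : C, IsIso (L.map (η.app X))) (X : C) (Z : L.EssImageSubcategory) :
    (L.toEssImage.obj X ⟶ Z) ≃ (X ⟶ L.essImage.ι.obj Z) :=
  L.essImage.fullyFaithfulι.homEquiv.trans
    (Equiv.ofBijective (fun g : L.obj X ⟶ Z.obj => η.app X ≫ g)
      (bijective_app_comp η h₁ h₂ X Z.property))

lemma toEssImageHomEquiv_apply (h₁ : ∀ X : C, IsIso (η.app (L.obj X)))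
    (h₂ : ∀ X : C, IsIso (L.map (η.app X))) {X : C} {Z : L.EssImageSubcategory}
    (g : L.toEssImage.obj X ⟶ Z) :
    toEssImageHomEquiv η h₁ h₂ X Z g = η.app X ≫ g.hom :=
  rfl

/-- An idempotent structure on `L` makes the corestriction of `L` to its essential image left
adjoint to the inclusion. -/
noncomputable def toEssImageAdjunction (h₁ : ∀ X : C, IsIso (η.app (L.obj X)))
    (h₂ : ∀ X : C, IsIso (L.map (η.app X))) : L.toEssImage ⊣ L.essImage.ι :=
  Adjunction.mkOfHomEquiv
    { homEquiv := toEssImageHomEquiv η h₁ h₂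
      homEquiv_naturality_left_symm := fun {X' X Z} f g => by
        obtain ⟨g, rfl⟩ := (toEssImageHomEquiv η h₁ h₂ X Z).surjective g
        rw [Equiv.symm_apply_eq, Equiv.symm_apply_apply]
        exact η.naturality_assoc f g.hom
      homEquiv_naturality_right := fun f g => (Category.assoc _ f.hom g.hom).symm }

end IdempotentEndofunctor

/-- If `L : C ⥤ C` has an idempotent structure `η`, let `W` be the class of
morphisms `f` such that `L.map f` is an isomorphism, and let `D` be the essential
image of `L`. Then the corestriction `L.toEssImage : C ⥤ D` inverts `W` and
exhibits `D` as the localization of `C` at `W`. -/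
theorem stmt_3 {C : Type*} [Category C] (L : C ⥤ C) (η : 𝟭 C ⟶ L)
    (h₁ : ∀ X : C, IsIso (η.app (L.obj X)))
    (h₂ : ∀ X : C, IsIso (L.map (η.app X)))
    (W : MorphismProperty C)
    (hW : ∀ ⦃X Y : C⦄ (f : X ⟶ Y), W f ↔ IsIso (L.map f)) :
    W.IsInvertedBy L.toEssImage ∧ L.toEssImage.IsLocalization W := by
  have hW' : W = (MorphismProperty.isomorphisms _).inverseImage L.toEssImage := by
    ext X Y f
    exact (hW f).trans (isIso_iff_of_reflects_iso (L.toEssImage.map f) L.essImage.ι)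
  have hloc : L.toEssImage.IsLocalization W := by
    rw [hW']
    exact (toEssImageAdjunction η h₁ h₂).isLocalization
  exact ⟨hloc.inverts, hloc⟩
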